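/- Let m ≥ 1 and d ≥ 2. The dimension of the ℂ-linear span of the trace polynomials {Tr(X_{τ(1)} X_{τ(2)} ⋯ X_{τ(d)}) : τ ∈ 𝔖_d} in the entries of d generic m×m matrices X₁,…,X_d (the multilinear part P̃_{m,d} of the cyclic trace space) equals the dimension of the multilinear part P_{m,d−1} of the ring of generic m×m matrices in d−1 variables, i.e. the dimension of the quotient of the span of the (d−1)! multilinear monomials x_{τ(1)}⋯x_{τ(d−1)} (τ ∈ 𝔖_{d−1}) in ℂ⟨x₁,…,x_{d−1}⟩ by its subspace of polynomial identities of m×m matrices. -/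

import Mathlib

/-- The `k`-th generic `m × m` matrix `Xₖ = (x^k_{ij})_{ij}` (among `d` generic
matrices), over the polynomial ring `ℂ[x^k_{ij} : 1 ≤ i,j ≤ m, 1 ≤ k ≤ d]`. -/
noncomputable def genMat (m d : ℕ) (k : Fin d) :
    Matrix (Fin m) (Fin m) (MvPolynomial (Fin d × Fin m × Fin m) ℂ) :=
  Matrix.of fun i j => MvPolynomial.X (k, i, j)

/-- The multilinear monomial `x_{τ(1)} ⋯ x_{τ(k)}` of the free algebra
`ℂ⟨x₁,…,x_k⟩` attached to a permutation `τ ∈ 𝔖_k`. -/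
noncomputable def freeMultilinearMonomial (k : ℕ) (τ : Equiv.Perm (Fin k)) :
    FreeAlgebra ℂ (Fin k) :=
  (List.ofFn fun j : Fin k => FreeAlgebra.ι ℂ (τ j)).prod

/-- The subspace of `ℂ⟨x₁,…,x_k⟩` of polynomial identities of `m × m` matrices. -/
noncomputable def piSpace (m k : ℕ) : Submodule ℂ (FreeAlgebra ℂ (Fin k)) where
  carrier := {f | ∀ A : Fin k → Matrix (Fin m) (Fin m) ℂ, FreeAlgebra.lift ℂ A f = 0}
  add_mem' := by
    intro a b ha hb A
    simp only [Set.mem_setOf_eq] at ha hb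
    simp [map_add, ha A, hb A]
  zero_mem' := by
    intro A
    simp
  smul_mem' := by
    intro c a ha A
    simp only [Set.mem_setOf_eq] at ha
    simp [map_smul, ha A]

/-- The span of the `k!` multilinear monomials `x_{τ(1)} ⋯ x_{τ(k)}`, `τ ∈ 𝔖_k`. -/
noncomputable def multilinearSpan (k : ℕ) : Submodule ℂ (FreeAlgebra ℂ (Fin k)) :=
  Submodule.span ℂ (Set.range (freeMultilinearMonomial k))

/-- The trace of a product of matrices is invariant under cyclic rotation of the factors. -/
theorem trace_prod_rotate {ι R : Type*} [Fintype ι] [DecidableEq ι] [CommRing R]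
    (l : List (Matrix ι ι R)) {k : ℕ} (hk : k ≤ l.length) :
    Matrix.trace (l.rotate k).prod = Matrix.trace l.prod := by
  rw [List.rotate_eq_drop_append_take hk, List.prod_append, Matrix.trace_mul_comm,
    ← List.prod_append, List.take_append_drop]

theorem ofFn_rotate_eq_ofFn_add {α : Type*} {n : ℕ} (f : Fin (n + 1) → α) (p : Fin (n + 1)) :
    (List.ofFn f).rotate p = List.ofFn fun j => f (j + p) := by
  refine List.ext_getElem (by simp) fun i h₁ h₂ => ?_
  simp only [List.getElem_rotate, List.getElem_ofFn, List.length_ofFn]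
  congr 1

/-- The linear map `f(x₁,…,x_n) ↦ Tr(X₀ f(X₁,…,X_n))`. -/
noncomputable def traceMap (m n : ℕ) :
    FreeAlgebra ℂ (Fin n) →ₗ[ℂ] MvPolynomial (Fin (n + 1) × Fin m × Fin m) ℂ :=
  Matrix.traceLinearMap (Fin m) ℂ _ ∘ₗ LinearMap.mulLeft ℂ (genMat m (n + 1) 0) ∘ₗ
    (FreeAlgebra.lift ℂ fun j : Fin n => genMat m (n + 1) j.succ).toLinearMap

theorem traceMap_apply (m n : ℕ) (f : FreeAlgebra ℂ (Fin n)) :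
    traceMap m n f = Matrix.trace (genMat m (n + 1) 0 *
      FreeAlgebra.lift ℂ (fun j : Fin n => genMat m (n + 1) j.succ) f) := rfl

theorem traceMap_freeMultilinearMonomial (m n : ℕ) (σ : Equiv.Perm (Fin n)) :
    traceMap m n (freeMultilinearMonomial n σ) =
      Matrix.trace (List.ofFn fun j : Fin (n + 1) =>
        genMat m (n + 1) (Equiv.Perm.decomposeFin.symm (0, σ) j)).prod := by
  rw [traceMap_apply, freeMultilinearMonomial, map_list_prod, List.map_ofFn, List.ofFn_succ,
    List.prod_cons]
  simp [Function.comp_def]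

theorem image_traceMap_range (m n : ℕ) :
    traceMap m n '' Set.range (freeMultilinearMonomial n) =
      Set.range fun τ : Equiv.Perm (Fin (n + 1)) =>
        Matrix.trace (List.ofFn fun j : Fin (n + 1) => genMat m (n + 1) (τ j)).prod := by
  ext q
  constructor
  · rintro ⟨_, ⟨σ, rfl⟩, rfl⟩
    exact ⟨_, (traceMap_freeMultilinearMonomial m n σ).symm⟩
  · rintro ⟨τ, rfl⟩
    obtain ⟨⟨p, σ⟩, hτ⟩ :=
      Equiv.Perm.decomposeFin.symm.surjective ((Equiv.addRight (τ.symm 0)).trans τ)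
    have hp : p = 0 := by
      have h := DFunLike.congr_fun hτ 0
      simpa using h
    subst hp
    refine ⟨_, ⟨σ, rfl⟩, ?_⟩
    beta_reduce
    rw [traceMap_freeMultilinearMonomial, hτ,
      ← trace_prod_rotate (List.ofFn fun j => genMat m (n + 1) (τ j))
        (k := (τ.symm 0 : Fin (n + 1))) (by simp),
      ofFn_rotate_eq_ofFn_add]
    rfl

theorem aeval_traceMap (m n : ℕ) (A : Fin (n + 1) → Matrix (Fin m) (Fin m) ℂ)
    (f : FreeAlgebra ℂ (Fin n)) :
    MvPolynomial.aeval (fun v : Fin (n + 1) × Fin m × Fin m => A v.1 v.2.1 v.2.2)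
        (traceMap m n f) =
      Matrix.trace (A 0 * FreeAlgebra.lift ℂ (fun j : Fin n => A j.succ) f) := by
  set e := MvPolynomial.aeval (R := ℂ)
    (fun v : Fin (n + 1) × Fin m × Fin m => A v.1 v.2.1 v.2.2)
  have hgen (k : Fin (n + 1)) : e.mapMatrix (genMat m (n + 1) k) = A k := by
    ext i j
    simp [e, genMat]
  have hlift : e.mapMatrix.comp (FreeAlgebra.lift ℂ fun j : Fin n => genMat m (n + 1) j.succ) =
      FreeAlgebra.lift ℂ fun j : Fin n => A j.succ := by
    ext1
    funext j
    simpa using hgen j.succ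
  rw [traceMap_apply, AddMonoidHom.map_trace, ← hlift, ← hgen 0, AlgHom.comp_apply, ← map_mul]
  rfl

theorem ker_traceMap (m n : ℕ) : LinearMap.ker (traceMap m n) = piSpace m n := by
  ext f
  rw [LinearMap.mem_ker]
  constructor
  · intro hf A
    refine Matrix.ext_iff_trace_mul_left.mpr fun B => ?_
    simpa [hf] using (aeval_traceMap m n (Fin.cons B A) f).symm
  · intro hf
    refine MvPolynomial.funext fun x => ?_
    have h := aeval_traceMap m n (fun k => Matrix.of fun i j => x (k, i, j)) f
    rw [hf, mul_zero, Matrix.trace_zero] at h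
    simpa [MvPolynomial.aeval_eq_eval] using h

/-- **The multilinear cyclic trace space**: for `m ≥ 1` and `d ≥ 2`, the dimension of
the span of the trace polynomials `Tr(X_{τ(1)} X_{τ(2)} ⋯ X_{τ(d)})`, `τ ∈ 𝔖_d`
(the multilinear part `P̃_{m,d}` of the cyclic trace space) equals the dimension of
the multilinear part `P_{m,d-1}` of the ring of generic `m × m` matrices in `d - 1`
variables, i.e. of the quotient of the span of the `(d-1)!` multilinear monomials
`x_{τ(1)} ⋯ x_{τ(d-1)}` by its subspace of polynomial identities of `m × m`
matrices. -/
theorem finrank_multilinear_cyclic_traces (m d : ℕ) (hm : 1 ≤ m) (hd : 2 ≤ d) :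
    Module.finrank ℂ ↥(Submodule.span ℂ (Set.range fun τ : Equiv.Perm (Fin d) =>
        Matrix.trace (List.ofFn fun j : Fin d => genMat m d (τ j)).prod)) =
      Module.finrank ℂ
        (↥(multilinearSpan (d - 1)) ⧸
          Submodule.comap (multilinearSpan (d - 1)).subtype (piSpace m (d - 1))) := by
  obtain ⟨n, rfl⟩ : ∃ n, d = n + 1 := ⟨d - 1, by omega⟩
  rw [Nat.add_sub_cancel, ← ker_traceMap, ← LinearMap.ker_comp, ← image_traceMap_range,
    ← Submodule.map_span]
  refine (LinearEquiv.finrank_eq ?_).symm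
  refine ((traceMap m n).comp (multilinearSpan n).subtype).quotKerEquivRange.trans
    (LinearEquiv.ofEq _ _ ?_)
  rw [LinearMap.range_comp, Submodule.range_subtype, multilinearSpan]
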